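/- Let ε ∈ (0,1), δ = ε², and γ = ε⁵/10³. Suppose v_1, …, v_k are vertices of M such that for every i ∈ {1, …, k}, Pr_{G*~G_p}[v_i ∈ PROBLEMATIC((v_1,…,v_{i−1}), G*)] ≥ δ. If |M| ≥ 4·log(2/δ), then k ≤ (ε²/100)·opt. -/

import Mathlib

open Finset

noncomputable section
open scoped Classical

variable {V : Type*} [Fintype V] [DecidableEq V]

/-- The probability that the realized graph `G* ~ G_p` (each edge of the base edge set `E`
kept independently with probability `p`) has edge set exactly `F`. -/
def edgeWeight (p : ℝ) (E F : Finset (Sym2 V)) : ℝ :=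
  p ^ F.card * (1 - p) ^ (E \ F).card

/-- The probability of an event `A` of the realized graph `G* ~ G_p`, where `E` is the
edge set of the base graph. -/
def probEvent (p : ℝ) (E : Finset (Sym2 V)) (A : Finset (Sym2 V) → Prop) : ℝ :=
  ∑ F ∈ E.powerset, if A F then edgeWeight p E F else 0

/-- The expectation of a real-valued function of the realized graph `G* ~ G_p`. -/
def expVal (p : ℝ) (E : Finset (Sym2 V)) (X : Finset (Sym2 V) → ℝ) : ℝ :=
  ∑ F ∈ E.powerset, edgeWeight p E F * X F

/-- `C` is a vertex cover of the graph with edge set `F`. -/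
def IsCoverOf (C : Finset V) (F : Finset (Sym2 V)) : Prop :=
  ∀ e ∈ F, ∃ v ∈ C, v ∈ e

/-- `MVC` assigns to every spanning subgraph of the base graph (given by its edge set
`F ⊆ E`) a vertex cover of minimum size. -/
def IsMinCoverFn (E : Finset (Sym2 V)) (MVC : Finset (Sym2 V) → Finset V) : Prop :=
  ∀ F ⊆ E, IsCoverOf (MVC F) F ∧ ∀ C : Finset V, IsCoverOf C F → (MVC F).card ≤ C.card

/-- `opt = E[|MVC(G*)|]`. -/
def optVal (p : ℝ) (E : Finset (Sym2 V)) (MVC : Finset (Sym2 V) → Finset V) : ℝ :=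
  expVal p E fun F => ((MVC F).card : ℝ)

/-- The number of edges of the induced subgraph `G[V \ S]` of the base graph. -/
def inducedEdgeCount (G : SimpleGraph V) [DecidableRel G.Adj] (S : Finset V) : ℕ :=
  (G.edgeFinset.filter fun e => ∀ v ∈ e, v ∉ S).card

/-- `DECIDED(Q, G*)` relative to the induced graphs on `M`: vertices of `M \ Q` having a
neighbor in `G*[M]` (realized edge set `F`) belonging to `Q \ VC(G*)`. -/
def decidedM (VC : Finset (Sym2 V) → Finset V) (M Q : Finset V)
    (F : Finset (Sym2 V)) : Finset V :=
  (M \ Q).filter fun v => ∃ u ∈ Q \ VC F, s(u, v) ∈ F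

/-- `UNDECIDED(Q, G*) = (M \ Q) \ DECIDED(Q, G*)`. -/
def undecidedM (VC : Finset (Sym2 V) → Finset V) (M Q : Finset V)
    (F : Finset (Sym2 V)) : Finset V :=
  (M \ Q) \ decidedM VC M Q F

/-- The set `A(G*)`: vertices of `M \ Q` with at least `1/(p·γ)` neighbors in `G[M]`
belonging to `UNDECIDED(Q, G*)`. -/
def heavySetM (G : SimpleGraph V) [DecidableRel G.Adj] (p γ : ℝ)
    (VC : Finset (Sym2 V) → Finset V) (M Q : Finset V) (F : Finset (Sym2 V)) : Finset V :=
  (M \ Q).filter fun v =>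
    1 / (p * γ) ≤ (((G.neighborFinset v ∩ M) ∩ undecidedM VC M Q F).card : ℝ)

/-- `PROBLEMATIC(Q, G*)` relative to the induced graphs on `M`: vertices `v ∈ M \ Q` with
`v ∉ VC(G*)` having at least `1/(p·γ)` neighbors in `G[M]` in `UNDECIDED(Q, G*)`. -/
def problematicM (G : SimpleGraph V) [DecidableRel G.Adj] (p γ : ℝ)
    (VC : Finset (Sym2 V) → Finset V) (M Q : Finset V) (F : Finset (Sym2 V)) : Finset V :=
  (M \ Q).filter fun v => v ∉ VC F ∧
    1 / (p * γ) ≤ (((G.neighborFinset v ∩ M) ∩ undecidedM VC M Q F).card : ℝ)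

lemma ite_helper {α : Type*} (s : Finset α) (P : α → Prop) (i1 : ∀ a, Decidable (P a))
    (i2 : DecidablePred P) (c : ℝ) :
    ∑ a ∈ s, (@ite _ (P a) (i1 a) c 0) = c * ((s.filter P).card : ℝ) := by
  have : i1 = i2 := Subsingleton.elim _ _
  subst this
  rw [← Finset.sum_filter, Finset.sum_const, nsmul_eq_mul, mul_comm]

lemma edgeWeight_nonneg' (p : ℝ) (hp0 : 0 < p) (hp1 : p ≤ 1) (E F : Finset (Sym2 V)) :
    0 ≤ edgeWeight p E F := by
  unfold edgeWeight
  have : 0 ≤ 1 - p := by linarith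
  positivity

lemma edgeWeight_total (p : ℝ) (E : Finset (Sym2 V)) :
    ∑ F ∈ E.powerset, edgeWeight p E F = 1 := by
  have h := Finset.sum_pow_mul_eq_add_pow p (1 - p) E
  simp only [add_sub_cancel, one_pow] at h
  rw [← h]
  apply Finset.sum_congr rfl
  intro F hF
  rw [Finset.mem_powerset] at hF
  unfold edgeWeight
  rw [Finset.card_sdiff_of_subset hF]

/-- multiplicative factor -/
def fac (p : ℝ) (A : Sym2 V → Finset (Sym2 V) → Prop) (e : Sym2 V) (F : Finset (Sym2 V)) : ℝ :=
  if A e F then (if e ∈ F then Real.exp (p / 2) / 2 else Real.exp (p / 2)) else 1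

lemma fac_nonneg (p : ℝ) (A : Sym2 V → Finset (Sym2 V) → Prop) (e : Sym2 V)
    (F : Finset (Sym2 V)) : 0 ≤ fac p A e F := by
  unfold fac
  split_ifs <;> positivity

lemma exp_prod_fac_le (p : ℝ) (hp0 : 0 < p) (hp1 : p ≤ 1)
    (A : Sym2 V → Finset (Sym2 V) → Prop) (r : Sym2 V → ℕ)
    (hA : ∀ e F F', (∀ e', r e' < r e → (e' ∈ F ↔ e' ∈ F')) → (A e F ↔ A e F'))
    (E : Finset (Sym2 V)) :
    ∑ F ∈ E.powerset, edgeWeight p E F * ∏ e ∈ E, fac p A e F ≤ 1 := by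
  induction E using Finset.induction_on_max_value r with
  | empty => simp [edgeWeight]
  | insert a s ha hmax ih =>
    rw [Finset.sum_powerset_insert ha, ← Finset.sum_add_distrib]
    refine le_trans (Finset.sum_le_sum ?_) ih
    intro F hF
    rw [Finset.mem_powerset] at hF
    have haF : a ∉ F := fun h => ha (hF h)
    have w1 : edgeWeight p (insert a s) F = (1 - p) * edgeWeight p s F := by
      unfold edgeWeight
      rw [Finset.insert_sdiff_of_notMem _ haF, Finset.card_insert_of_notMem (by simp [ha])]
      ring
    have w2 : edgeWeight p (insert a s) (insert a F) = p * edgeWeight p s F := by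
      unfold edgeWeight
      rw [Finset.insert_sdiff_insert, Finset.sdiff_insert_of_notMem ha,
        Finset.card_insert_of_notMem haF]
      ring
    have hagree : ∀ e, r e ≤ r a → (A e (insert a F) ↔ A e F) := by
      intro e he
      apply hA
      intro e' he'
      have : e' ≠ a := by rintro rfl; omega
      simp [this]
    have p1 : ∏ e ∈ s, fac p A e (insert a F) = ∏ e ∈ s, fac p A e F := by
      apply Finset.prod_congr rfl
      intro e he
      have hne : e ≠ a := by rintro rfl; exact ha he
      unfold fac
      simp only [hagree e (hmax e he), Finset.mem_insert, hne, false_or]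
    rw [w1, w2, Finset.prod_insert ha, Finset.prod_insert ha, p1]
    have key : (1 - p) * fac p A a F + p * fac p A a (insert a F) ≤ 1 := by
      unfold fac
      simp only [hagree a le_rfl, Finset.mem_insert, true_or, if_true, haF, if_false]
      split_ifs
      · have h1 : 1 - p / 2 ≤ Real.exp (-(p/2)) := by
          have := Real.add_one_le_exp (-(p/2)); linarith
        have h2 : Real.exp (-(p/2)) * Real.exp (p/2) = 1 := by
          rw [← Real.exp_add]; simp
        nlinarith [Real.exp_pos (p/2)]
      · linarith
    have hn : 0 ≤ edgeWeight p s F * ∏ e ∈ s, fac p A e F :=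
      mul_nonneg (edgeWeight_nonneg' p hp0 hp1 s F)
        (Finset.prod_nonneg fun e _ => fac_nonneg p A e F)
    calc _ = (edgeWeight p s F * ∏ e ∈ s, fac p A e F) *
          ((1 - p) * fac p A a F + p * fac p A a (insert a F)) := by ring
      _ ≤ _ := mul_le_of_le_one_right hn key

lemma prod_fac_eq (p : ℝ) (A : Sym2 V → Finset (Sym2 V) → Prop) (E F : Finset (Sym2 V))
    (hF : F ⊆ E) :
    ∏ e ∈ E, fac p A e F = Real.exp (p / 2 * ((E.filter fun e => A e F).card : ℝ)
      - Real.log 2 * ((F.filter fun e => A e F).card : ℝ)) := by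
  have h : ∀ e ∈ E, fac p A e F = Real.exp ((if A e F then p / 2 else 0)
      - (if A e F ∧ e ∈ F then Real.log 2 else 0)) := by
    intro e _
    unfold fac
    by_cases h1 : A e F <;> by_cases h2 : e ∈ F <;> simp [h1, h2, Real.exp_sub, Real.exp_log]
  rw [Finset.prod_congr rfl h, ← Real.exp_sum, Finset.sum_sub_distrib,
    ← Finset.sum_filter, ← Finset.sum_filter]
  have : (E.filter fun e => A e F ∧ e ∈ F) = F.filter fun e => A e F := by
    ext e; simp only [Finset.mem_filter]
    constructor
    · tauto
    · rintro ⟨a, b⟩; exact ⟨hF a, b, a⟩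
  rw [this]
  simp only [Finset.sum_const, nsmul_eq_mul]
  ring_nf

/-- active edges -/
def actE {k : ℕ} (v : Fin k → V) (M : Finset V) (I : Finset (Fin k)) (e : Sym2 V)
    (F : Finset (Sym2 V)) : Prop :=
  ∃ j ∈ I, ∃ u ∈ M, e = s(v j, u) ∧ (∀ i, i < j → v i ≠ u) ∧
    (∀ i ∈ I, i < j → s(v i, u) ∉ F)

/-- index of a vertex -/
def vidx {k : ℕ} (v : Fin k → V) (w : V) : ℕ :=
  if h : ∃ j, v j = w then (h.choose : ℕ) else k

lemma vidx_apply {k : ℕ} (v : Fin k → V) (hv : Function.Injective v) (j : Fin k) :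
    vidx v (v j) = j := by
  unfold vidx
  have h : ∃ i, v i = v j := ⟨j, rfl⟩
  rw [dif_pos h, hv h.choose_spec]

lemma le_vidx {k : ℕ} (v : Fin k → V) (j : Fin k) (u : V) (h : ∀ i, i < j → v i ≠ u) :
    (j : ℕ) ≤ vidx v u := by
  unfold vidx
  split_ifs with h'
  · by_contra hc
    exact h _ (by rw [Fin.lt_def]; omega) h'.choose_spec
  · exact j.2.le

/-- rank of an edge -/
def erank {k : ℕ} (v : Fin k → V) : Sym2 V → ℕ :=
  Sym2.lift ⟨fun a b => min (vidx v a) (vidx v b), fun a b => min_comm _ _⟩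

lemma actE_dep {k : ℕ} (v : Fin k → V) (hv : Function.Injective v) (M : Finset V)
    (I : Finset (Fin k)) (e : Sym2 V) (F F' : Finset (Sym2 V))
    (h : ∀ e', erank v e' < erank v e → (e' ∈ F ↔ e' ∈ F')) :
    actE v M I e F ↔ actE v M I e F' := by
  unfold actE
  refine exists_congr fun j => and_congr_right fun hj => exists_congr fun u =>
    and_congr_right fun hu => and_congr_right fun he => and_congr_right fun hlt => ?_
  refine forall_congr' fun i => forall_congr' fun hi => forall_congr' fun hij => ?_
  rw [h]
  rw [he]
  have := le_vidx v j u hlt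
  simp only [erank, Sym2.lift_mk, vidx_apply v hv]
  rw [Fin.lt_def] at hij
  omega

lemma card_act_le {k : ℕ} (v : Fin k → V) (M : Finset V)
    (I : Finset (Fin k)) (F : Finset (Sym2 V)) :
    (F.filter fun e => actE v M I e F).card ≤ M.card := by
  have H : ∀ e ∈ F.filter (fun e => actE v M I e F), ∃ u, ∃ j ∈ I, u ∈ M ∧ e = s(v j, u) ∧
      (∀ i ∈ I, i < j → s(v i, u) ∉ F) := by
    intro e he
    obtain ⟨-, j, hj, u, hu, h1, -, h3⟩ := Finset.mem_filter.1 he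
    exact ⟨u, j, hj, hu, h1, h3⟩
  rcases (F.filter fun e => actE v M I e F).eq_empty_or_nonempty with h0 | ⟨e0, he0⟩
  · rw [h0]; simp
  obtain ⟨u0, j0, -⟩ := H e0 he0
  haveI : Nonempty V := ⟨u0⟩
  haveI : Nonempty (Fin k) := ⟨j0⟩
  choose! f g hg hf he hlt using H
  refine Finset.card_le_card_of_injOn f (fun e h => hf e h) ?_
  intro e h e' h' hff
  have hF : e ∈ F := (Finset.mem_filter.1 h).1
  have hF' : e' ∈ F := (Finset.mem_filter.1 h').1
  rcases lt_trichotomy (g e) (g e') with hl | hl | hl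
  · exfalso
    apply hlt e' h' (g e) (hg e h) hl
    rw [← hff, ← he e h]; exact hF
  · rw [he e h, he e' h', hl, hff]
  · exfalso
    apply hlt e h (g e') (hg e' h') hl
    rw [hff, ← he e' h']; exact hF'

lemma card_act_ge (G : SimpleGraph V) [DecidableRel G.Adj] {k : ℕ} (v : Fin k → V)
    (hv : Function.Injective v) (p γ : ℝ) (MVC : Finset (Sym2 V) → Finset V)
    (M : Finset V) (F : Finset (Sym2 V)) :
    (((Finset.univ : Finset (Fin k)).filter fun i => v i ∈ problematicM G p γ MVC M
          (((Finset.univ : Finset (Fin k)).filter fun j => j < i).image v) F).card : ℝ)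
        * (1 / (p * γ)) ≤
      ((G.edgeFinset.filter fun e =>
        actE v M (Finset.univ.filter fun i => v i ∉ MVC F) e F).card : ℝ) := by
  set T := (Finset.univ : Finset (Fin k)).filter fun i => v i ∈ problematicM G p γ MVC M
          (((Finset.univ : Finset (Fin k)).filter fun j => j < i).image v) F with hT
  let N : Fin k → Finset V := fun i => (G.neighborFinset (v i) ∩ M) ∩ undecidedM MVC M
    (((Finset.univ : Finset (Fin k)).filter fun j => j < i).image v) F
  have h1 : (T.card : ℝ) * (1 / (p * γ)) ≤ ((T.sigma N).card : ℝ) := by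
    rw [Finset.card_sigma]
    push_cast
    rw [← nsmul_eq_mul]
    apply Finset.card_nsmul_le_sum
    intro i hi
    rw [hT, Finset.mem_filter] at hi
    have := (Finset.mem_filter.1 hi.2).2.2
    exact this
  refine h1.trans ?_
  norm_cast
  have hN : ∀ i u, u ∈ N i → G.Adj (v i) u ∧ u ∈ M ∧ (∀ j, j < i → v j ≠ u) ∧
      (∀ j, v j ∉ MVC F → j < i → s(v j, u) ∉ F) := by
    intro i u hu
    simp only [N, undecidedM, decidedM, Finset.mem_inter, SimpleGraph.mem_neighborFinset,
      Finset.mem_sdiff, Finset.mem_filter, Finset.mem_image, Finset.mem_univ, true_and] at hu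
    obtain ⟨⟨h1, h2⟩, ⟨-, h3⟩, h4⟩ := hu
    refine ⟨h1, h2, fun j hj hju => h3 ⟨j, hj, hju⟩, fun j hj hji hF => h4 ⟨⟨h2, h3⟩, v j, ⟨⟨j, hji, rfl⟩, hj⟩, hF⟩⟩
  refine Finset.card_le_card_of_injOn (fun x => s(v x.1, x.2)) ?_ ?_
  · rintro ⟨i, u⟩ hx
    rw [Finset.mem_coe, Finset.mem_sigma] at hx
    obtain ⟨hi, hu⟩ := hx
    obtain ⟨a1, a2, a3, a4⟩ := hN i u hu
    rw [hT, Finset.mem_filter] at hi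
    have hi2 : v i ∉ MVC F := (Finset.mem_filter.1 hi.2).2.1
    simp only [Finset.coe_filter, Set.mem_ofPred_eq, SimpleGraph.mem_edgeFinset,
      SimpleGraph.mem_edgeSet]
    refine ⟨a1, i, by simpa using hi2, u, a2, rfl, a3, ?_⟩
    intro j hj hji
    exact a4 j (by simpa using hj) hji
  · rintro ⟨i, u⟩ hx ⟨i', u'⟩ hx' heq
    rw [Finset.mem_coe, Finset.mem_sigma] at hx hx'
    obtain ⟨-, -, a3, -⟩ := hN i u hx.2
    obtain ⟨-, -, b3, -⟩ := hN i' u' hx'.2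
    dsimp only at heq
    rw [Sym2.eq_iff] at heq
    rcases heq with ⟨h1, h2⟩ | ⟨h1, h2⟩
    · obtain rfl := hv h1
      subst h2; rfl
    · dsimp only at *
      rcases lt_trichotomy i i' with hl | hl | hl
      · exact absurd h1 (b3 i hl)
      · subst hl
        rw [← h1, h2]
      · exact absurd h2.symm (a3 i' hl)

/-- Claim 4.4 / Lemma 4.1 applied to `G[M]`. Let `ε ∈ (0,1)`,
`δ = ε²`, `γ = ε⁵/10³`. Suppose `v_1, …, v_k` are vertices of `M` such that for every
`i`, `Pr_{G*~G_p}[v_i ∈ PROBLEMATIC((v_1,…,v_{i−1}), G*)] ≥ δ`. If `|M| ≥ 4·log(2/δ)`,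
then `k ≤ (ε²/100)·opt`. -/
theorem vertex_seed_bound_on_M
    (G : SimpleGraph V) [DecidableRel G.Adj]
    (p : ℝ) (hp0 : 0 < p) (hp1 : p ≤ 1)
    (MVC : Finset (Sym2 V) → Finset V)
    (hMVC : IsMinCoverFn G.edgeFinset MVC)
    (opt : ℝ) (hopt : opt = optVal p G.edgeFinset MVC)
    (ε : ℝ) (hε0 : 0 < ε) (hε1 : ε < 1)
    (δ γ : ℝ) (hδ : δ = ε ^ 2) (hγ : γ = ε ^ 5 / 10 ^ 3)
    (M : Finset V)
    (hM : M = Finset.univ.filter fun v =>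
      ε < probEvent p G.edgeFinset (fun F => v ∈ MVC F) ∧
      probEvent p G.edgeFinset (fun F => v ∈ MVC F) < 1 - 2 * ε)
    (k : ℕ) (v : Fin k → V) (hv : ∀ i, v i ∈ M)
    (hprob : ∀ i : Fin k,
      δ ≤ probEvent p G.edgeFinset (fun F =>
        v i ∈ problematicM G p γ MVC M
          (((Finset.univ : Finset (Fin k)).filter fun j => j < i).image v) F))
    (hn : 4 * Real.log (2 / δ) ≤ (M.card : ℝ)) :
    (k : ℝ) ≤ ε ^ 2 / 100 * opt := by
  have hδ0 : 0 < δ := by rw [hδ]; positivity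
  have hγ0 : 0 < γ := by rw [hγ]; positivity
  set E := G.edgeFinset with hE
  have hw : ∀ F, 0 ≤ edgeWeight p E F := fun F => edgeWeight_nonneg' p hp0 hp1 E F
  have hinj : Function.Injective v := by
    have hlt : ∀ i j : Fin k, i < j → v i ≠ v j := by
      intro i j hij heq
      have h0 := hprob j
      have : probEvent p E (fun F => v j ∈ problematicM G p γ MVC M
          (((Finset.univ : Finset (Fin k)).filter fun l => l < j).image v) F) = 0 := by
        unfold probEvent
        apply Finset.sum_eq_zero
        intro F _
        rw [if_neg]
        intro hmem
        have h2 := (Finset.mem_sdiff.1 (Finset.mem_filter.1 hmem).1).2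
        exact h2 (Finset.mem_image.2 ⟨i, by simpa using hij, heq⟩)
      linarith
    intro i j h
    rcases lt_trichotomy i j with hl | hl | hl
    · exact absurd h (hlt i j hl)
    · exact hl
    · exact absurd h.symm (hlt j i hl)
  have hkM : k ≤ M.card := by
    have := Finset.card_le_card_of_injOn (s := (Finset.univ : Finset (Fin k))) (t := M) v
      (fun i _ => hv i) hinj.injOn
    simpa using this
  -- opt lower bound
  have hoptM : ε * (M.card : ℝ) ≤ opt := by
    have h1 : ∑ w ∈ M, probEvent p E (fun F => w ∈ MVC F) ≤ opt := by
      rw [hopt]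
      unfold probEvent optVal expVal
      rw [Finset.sum_comm]
      apply Finset.sum_le_sum
      intro F _
      refine le_trans (le_of_eq (ite_helper M (fun x => x ∈ MVC F) _ inferInstance _)) ?_
      apply mul_le_mul_of_nonneg_left _ (hw F)
      beta_reduce
      norm_cast
      apply Finset.card_le_card
      intro w hw'
      exact (Finset.mem_filter.1 hw').2
    have h2 : (M.card : ℝ) * ε ≤ ∑ w ∈ M, probEvent p E (fun F => w ∈ MVC F) := by
      rw [← nsmul_eq_mul]
      apply Finset.card_nsmul_le_sum
      intro w hw'
      rw [hM, Finset.mem_filter] at hw'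
      exact hw'.2.1.le
    linarith
  let T : Finset (Sym2 V) → Finset (Fin k) := fun F =>
    (Finset.univ : Finset (Fin k)).filter fun i => v i ∈ problematicM G p γ MVC M
          (((Finset.univ : Finset (Fin k)).filter fun j => j < i).image v) F
  have hET : (k : ℝ) * δ ≤ ∑ F ∈ E.powerset, edgeWeight p E F * ((T F).card : ℝ) := by
    have h1 : (k : ℝ) * δ ≤ ∑ i : Fin k, probEvent p E (fun F =>
        v i ∈ problematicM G p γ MVC M
          (((Finset.univ : Finset (Fin k)).filter fun j => j < i).image v) F) := by
      have := Finset.card_nsmul_le_sum (Finset.univ : Finset (Fin k)) _ δ (fun i _ => hprob i)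
      simpa using this
    refine h1.trans (le_of_eq ?_)
    unfold probEvent
    rw [Finset.sum_comm]
    apply Finset.sum_congr rfl
    intro F _
    exact ite_helper Finset.univ (fun i => v i ∈ problematicM G p γ MVC M
          (((Finset.univ : Finset (Fin k)).filter fun j => j < i).image v) F) _ _ _
  let Z : Finset (Fin k) → Finset (Sym2 V) → ℝ := fun I F => ∏ e ∈ E, fac p (actE v M I) e F
  have hZ : ∀ I, ∑ F ∈ E.powerset, edgeWeight p E F * Z I F ≤ 1 := fun I =>
    exp_prod_fac_le p hp0 hp1 (actE v M I) (erank v) (actE_dep v hinj M I) E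
  have hZ0 : ∀ I F, 0 ≤ Z I F := fun I F => Finset.prod_nonneg fun e _ => fac_nonneg _ _ _ _
  set L := Real.log 2 with hL
  have hL0 : 0 < L := Real.log_pos (by norm_num)
  have hpt : ∀ F ∈ E.powerset, 1 + (((T F).card : ℝ) / (2 * γ) - L * M.card - L * k) ≤
      (∑ I : Finset (Fin k), Z I F) * Real.exp (-(L * k)) := by
    intro F hF
    rw [Finset.mem_powerset] at hF
    have h1 : Z (Finset.univ.filter fun i => v i ∉ MVC F) F ≤ ∑ I : Finset (Fin k), Z I F :=
      Finset.single_le_sum (f := fun I => Z I F) (fun I _ => hZ0 I F) (Finset.mem_univ _)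
    have h2 : Real.exp (((T F).card : ℝ) / (2 * γ) - L * M.card) ≤
        Z (Finset.univ.filter fun i => v i ∉ MVC F) F := by
      simp only [Z]
      rw [prod_fac_eq p _ E F hF]
      apply Real.exp_le_exp.2
      have a := card_act_ge G v hinj p γ MVC M F
      have b : (((F.filter fun e => actE v M (Finset.univ.filter fun i => v i ∉ MVC F) e F).card : ℕ) : ℝ)
        ≤ M.card := by exact_mod_cast card_act_le v M _ F
      have a' := mul_le_mul_of_nonneg_left a (by positivity : 0 ≤ p / 2)
      have e1 : p / 2 * (((T F).card : ℝ) * (1 / (p * γ))) = ((T F).card : ℝ) / (2 * γ) := by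
        field_simp
      have b' := mul_le_mul_of_nonneg_left b hL0.le
      change p / 2 * (((T F).card : ℝ) * (1 / (p * γ))) ≤ _ at a'
      rw [e1] at a'
      linarith
    have h3 := Real.add_one_le_exp (((T F).card : ℝ) / (2 * γ) - L * M.card - L * k)
    rw [sub_eq_add_neg _ (L * (k:ℝ)), Real.exp_add] at h3
    have h4 := mul_le_mul_of_nonneg_right (h2.trans h1) (Real.exp_pos (-(L * k))).le
    linarith
  have hsum := Finset.sum_le_sum fun F hF => mul_le_mul_of_nonneg_left (hpt F hF) (hw F)
  have hR : ∑ F ∈ E.powerset, edgeWeight p E F *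
      ((∑ I : Finset (Fin k), Z I F) * Real.exp (-(L * k))) ≤ 1 := by
    have e1 : ∑ F ∈ E.powerset, edgeWeight p E F *
      ((∑ I : Finset (Fin k), Z I F) * Real.exp (-(L * k))) =
      (∑ I : Finset (Fin k), ∑ F ∈ E.powerset, edgeWeight p E F * Z I F) *
        Real.exp (-(L * k)) := by
      rw [Finset.sum_comm, Finset.sum_mul]
      apply Finset.sum_congr rfl
      intro F _
      rw [← Finset.mul_sum]; ring
    rw [e1]
    have e2 : ∑ I : Finset (Fin k), ∑ F ∈ E.powerset, edgeWeight p E F * Z I F ≤ 2 ^ k := by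
      have := Finset.sum_le_card_nsmul (Finset.univ : Finset (Finset (Fin k))) _ 1
        (fun I _ => hZ I)
      simpa using this
    have e3 : Real.exp (-(L * k)) = ((2:ℝ) ^ k)⁻¹ := by
      rw [Real.exp_neg, mul_comm, Real.exp_nat_mul, Real.exp_log (by norm_num)]
    rw [e3]
    calc _ ≤ (2:ℝ) ^ k * ((2:ℝ) ^ k)⁻¹ := by gcongr
      _ = 1 := by field_simp
  have hLft : ∑ F ∈ E.powerset, edgeWeight p E F *
      (1 + (((T F).card : ℝ) / (2 * γ) - L * M.card - L * k)) =
      (∑ F ∈ E.powerset, edgeWeight p E F * ((T F).card : ℝ)) / (2 * γ) +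
        (1 - L * M.card - L * k) := by
    have : (1 - L * M.card - L * k) = (∑ F ∈ E.powerset, edgeWeight p E F) *
      (1 - L * M.card - L * k) := by rw [edgeWeight_total]; ring
    rw [this, Finset.sum_mul, Finset.sum_div, ← Finset.sum_add_distrib]
    apply Finset.sum_congr rfl
    intro F _
    ring
  rw [hLft] at hsum
  have hfin : (k : ℝ) * δ / (2 * γ) ≤ L * M.card + L * k := by
    have : (k : ℝ) * δ / (2 * γ) ≤
      (∑ F ∈ E.powerset, edgeWeight p E F * ((T F).card : ℝ)) / (2 * γ) := by gcongr
    linarith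
  have hk' : (k : ℝ) ≤ M.card := by exact_mod_cast hkM
  have hL1 : L ≤ 1 := by have := Real.log_two_lt_d9; linarith
  have hM0 : (0:ℝ) ≤ M.card := by positivity
  have hk0 : (0:ℝ) ≤ k := by positivity
  have hfin2 : (k : ℝ) * δ / (2 * γ) ≤ 2 * M.card := by nlinarith
  rw [div_le_iff₀ (by positivity), hδ, hγ] at hfin2
  have hk3 : (k : ℝ) ≤ ε ^ 3 / 250 * M.card := by
    have he2 : 0 < ε ^ 2 := by positivity
    refine le_of_mul_le_mul_right ?_ he2
    refine hfin2.trans (le_of_eq ?_)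
    ring
  have hk4 : ε ^ 2 / 100 * (ε * M.card) ≤ ε ^ 2 / 100 * opt := by gcongr
  have : 0 ≤ ε ^ 3 * M.card := by positivity
  nlinarith
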